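/- Let r ≥ 1, let ν > r − 1 be real, and let S be a symmetric positive definite r×r real matrix. Then ∫ p_IW(D; ν, S) · log det D dD = log det S − ∑_{l=1}^r ψ((ν − l + 1)/2) − r·log 2, where the integral is over the cone of symmetric positive definite r×r matrices D (with respect to Lebesgue measure on the r(r+1)/2 on-and-below-diagonal entries of D), and ψ = (log Γ)′ is the digamma function. -/

import Mathlib

open MeasureTheory Matrix Real Finset

/-- The digamma function `ψ = (log Γ)′`. -/
noncomputable def digamma (x : ℝ) : ℝ := deriv (fun y => Real.log (Real.Gamma y)) x

/-- The multivariate gamma function `Γ_r(a) = π^{r(r-1)/4} ∏_{l=1}^r Γ(a + (1-l)/2)`. -/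
noncomputable def multivariateGamma (r : ℕ) (a : ℝ) : ℝ :=
  Real.pi ^ ((r : ℝ) * ((r : ℝ) - 1) / 4) *
    ∏ l ∈ Finset.Icc 1 r, Real.Gamma (a + (1 - (l : ℝ)) / 2)

/-- The inverse Wishart density `p_IW(D; ν, S)` on the cone of symmetric positive definite
`r×r` matrices (w.r.t. Lebesgue measure on the on-and-below-diagonal entries):
`det(S)^{ν/2} 2^{-νr/2} Γ_r(ν/2)⁻¹ det(D)^{-(ν+r+1)/2} exp(-(1/2) tr(S D⁻¹))`. -/
noncomputable def invWishartDensity (r : ℕ) (ν : ℝ) (S D : Matrix (Fin r) (Fin r) ℝ) : ℝ :=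
  S.det ^ (ν / 2) * (2 : ℝ) ^ (-(ν * (r : ℝ)) / 2) / multivariateGamma r (ν / 2) *
    D.det ^ (-(ν + (r : ℝ) + 1) / 2) * Real.exp (-(1 / 2) * (S * D⁻¹).trace)

/-- The symmetric matrix built from a vector of on-and-below-diagonal entries. -/
noncomputable def lowerToSym {r : ℕ} (v : {q : Fin r × Fin r // q.2 ≤ q.1} → ℝ) :
    Matrix (Fin r) (Fin r) ℝ :=
  Matrix.of fun k m => if h : m ≤ k then v ⟨(k, m), h⟩ else v ⟨(m, k), (not_le.mp h).le⟩

/-- Integral of a function `f` over the cone of symmetric positive definite `r×r` matrices,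
with respect to Lebesgue measure on the `r(r+1)/2` on-and-below-diagonal entries. -/
noncomputable def spdIntegral (r : ℕ) (f : Matrix (Fin r) (Fin r) ℝ → ℝ) : ℝ :=
  ∫ v : {q : Fin r × Fin r // q.2 ≤ q.1} → ℝ,
    Set.indicator {w : {q : Fin r × Fin r // q.2 ≤ q.1} → ℝ | (lowerToSym w).PosDef}
      (fun w => f (lowerToSym w)) v


/-- The symmetric matrix obtained from `A` by appending the last row and column `(b, c)`. -/
noncomputable def borderedMatrix {r : ℕ} (A : Matrix (Fin r) (Fin r) ℝ) (b : Fin r → ℝ) (c : ℝ) :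
    Matrix (Fin (r + 1)) (Fin (r + 1)) ℝ :=
  (fromBlocks A (replicateCol (Fin 1) b) (replicateCol (Fin 1) b)ᴴ (c • 1)).submatrix
    finSumFinEquiv.symm finSumFinEquiv.symm

lemma eq_borderedMatrix {r : ℕ} {M : Matrix (Fin (r + 1)) (Fin (r + 1)) ℝ} (hM : M.IsHermitian) :
    M = borderedMatrix (M.submatrix Fin.castSucc Fin.castSucc)
      (fun i => M i.castSucc (Fin.last r)) (M (Fin.last r) (Fin.last r)) := by
  apply Matrix.ext
  intro i j
  obtain ⟨i, rfl⟩ := finSumFinEquiv.surjective i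
  obtain ⟨j, rfl⟩ := finSumFinEquiv.surjective j
  have h0 : Fin.natAdd r (0 : Fin 1) = Fin.last r := by ext; simp
  rcases i with i | i <;> rcases j with j | j
  · simp [borderedMatrix, Fin.castSucc]
  · rw [Subsingleton.elim j 0]
    simp [borderedMatrix, Fin.castSucc, h0]
  · rw [Subsingleton.elim i 0]
    have := hM.apply (Fin.last r) j.castSucc
    simp only [star_trivial] at this
    simpa [borderedMatrix, h0, Fin.castSucc] using this.symm
  · rw [Subsingleton.elim i 0, Subsingleton.elim j 0]
    simp [borderedMatrix, h0]

lemma conjTranspose_replicateCol_mul_mul {r : ℕ} (A : Matrix (Fin r) (Fin r) ℝ) (b : Fin r → ℝ) :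
    (replicateCol (Fin 1) b)ᴴ * A * replicateCol (Fin 1) b = (b ⬝ᵥ A *ᵥ b) • 1 := by
  ext i j
  rw [Subsingleton.elim i j]
  rw [dotProduct_mulVec]
  simp [Matrix.mul_apply, dotProduct, vecMul]

lemma det_borderedMatrix {r : ℕ} {A : Matrix (Fin r) (Fin r) ℝ} (hA : A.det ≠ 0)
    (b : Fin r → ℝ) (c : ℝ) :
    (borderedMatrix A b c).det = A.det * (c - b ⬝ᵥ A⁻¹ *ᵥ b) := by
  have := A.invertibleOfIsUnitDet hA.isUnit
  rw [borderedMatrix, det_submatrix_equiv_self, det_fromBlocks₁₁, invOf_eq_nonsing_inv,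
    conjTranspose_replicateCol_mul_mul]
  simp

lemma posDef_borderedMatrix_iff {r : ℕ} {A : Matrix (Fin r) (Fin r) ℝ} (hA : A.PosDef)
    (b : Fin r → ℝ) (c : ℝ) :
    (borderedMatrix A b c).PosDef ↔ 0 < c - b ⬝ᵥ A⁻¹ *ᵥ b := by
  have hdet := det_borderedMatrix hA.det_pos.ne' b c
  constructor
  · intro h
    have := h.det_pos
    rw [hdet] at this
    exact (mul_pos_iff_of_pos_left hA.det_pos).1 this
  · intro h
    have := A.invertibleOfIsUnitDet hA.det_pos.ne'.isUnit
    have hps : (borderedMatrix A b c).PosSemidef := by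
      rw [borderedMatrix, posSemidef_submatrix_equiv, PosDef.fromBlocks₁₁ _ _ hA,
        conjTranspose_replicateCol_mul_mul]
      rw [← sub_smul]
      exact PosSemidef.one.smul h.le
    refine hps.posDef_iff_isUnit.2 ?_
    rw [isUnit_iff_isUnit_det, hdet]
    exact (mul_pos hA.det_pos h).ne'.isUnit

lemma borderedMatrix_submatrix_castSucc {r : ℕ} (A : Matrix (Fin r) (Fin r) ℝ) (b : Fin r → ℝ)
    (c : ℝ) : (borderedMatrix A b c).submatrix Fin.castSucc Fin.castSucc = A := by
  ext i j
  have h : ∀ k : Fin r, finSumFinEquiv.symm k.castSucc = (Sum.inl k : Fin r ⊕ Fin 1) :=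
    fun k => finSumFinEquiv_symm_apply_castAdd k
  simp [borderedMatrix, h]

lemma posDef_of_posDef_borderedMatrix {r : ℕ} {A : Matrix (Fin r) (Fin r) ℝ} {b : Fin r → ℝ}
    {c : ℝ} (h : (borderedMatrix A b c).PosDef) : A.PosDef := by
  rw [← borderedMatrix_submatrix_castSucc A b c]
  exact h.submatrix (Fin.castSucc_injective r)

/-- Completing the square in `tr (S D⁻¹)` for matrices `S` and `D` bordered by one row and column,
where the leading block of `S` is `Lᵀ L`. -/
lemma trace_borderedMatrix_mul_inv {r : ℕ} {A : Matrix (Fin r) (Fin r) ℝ} (hA : A.PosDef)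
    (b : Fin r → ℝ) (c : ℝ) (hs : 0 < c - b ⬝ᵥ A⁻¹ *ᵥ b)
    (L : Matrix (Fin r) (Fin r) ℝ) (y : Fin r → ℝ) (u : ℝ) :
    (borderedMatrix (Lᵀ * L) (Lᵀ *ᵥ y) u * (borderedMatrix A b c)⁻¹).trace =
      (Lᵀ * L * A⁻¹).trace + (c - b ⬝ᵥ A⁻¹ *ᵥ b)⁻¹ *
        (∑ i, (((L * A⁻¹) *ᵥ b) i - y i) ^ 2 + (u - y ⬝ᵥ y)) := by
  set s := c - b ⬝ᵥ A⁻¹ *ᵥ b with hsdef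
  set β := A⁻¹ *ᵥ b with hβ
  have hAA : A * A⁻¹ = 1 := A.mul_nonsing_inv hA.det_pos.ne'.isUnit
  have hAβ : A *ᵥ β = b := by rw [hβ, mulVec_mulVec, hAA, one_mulVec]
  have hβ' : b ᵥ* A⁻¹ = β := by
    rw [hβ, ← mulVec_transpose, transpose_nonsing_inv]
    congr 2
    simpa using hA.1.eq
  have hinv : (borderedMatrix A b c)⁻¹ =
      borderedMatrix (A⁻¹ + s⁻¹ • vecMulVec β β) (-s⁻¹ • β) s⁻¹ := by
    apply inv_eq_right_inv
    rw [borderedMatrix, borderedMatrix, submatrix_mul_equiv, fromBlocks_multiply]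
    have h11 : A * (A⁻¹ + s⁻¹ • vecMulVec β β) + replicateCol (Fin 1) b *
        (replicateCol (Fin 1) (-s⁻¹ • β))ᴴ = 1 := by
      rw [Matrix.mul_add, hAA, Matrix.mul_smul, mul_vecMulVec, hAβ]
      ext i j
      simp [Matrix.mul_apply, vecMulVec_apply]
      ring
    have h12 : A * replicateCol (Fin 1) (-s⁻¹ • β) + replicateCol (Fin 1) b *
        (s⁻¹ • (1 : Matrix (Fin 1) (Fin 1) ℝ)) = 0 := by
      rw [← replicateCol_mulVec, mulVec_smul, hAβ]
      ext i j
      simp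
    have h21 : (replicateCol (Fin 1) b)ᴴ * (A⁻¹ + s⁻¹ • vecMulVec β β) +
        (c • (1 : Matrix (Fin 1) (Fin 1) ℝ)) * (replicateCol (Fin 1) (-s⁻¹ • β))ᴴ = 0 := by
      ext i j
      have e1 : ((replicateCol (Fin 1) b)ᴴ * A⁻¹) i j = β j := by
        rw [← hβ']; simp [Matrix.mul_apply, vecMul, dotProduct]
      have e2 : ((replicateCol (Fin 1) b)ᴴ * vecMulVec β β) i j = (b ⬝ᵥ β) * β j := by
        simp [Matrix.mul_apply, vecMulVec_apply, dotProduct, Finset.sum_mul, mul_assoc]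
      rw [Matrix.mul_add, Matrix.mul_smul]
      simp only [Matrix.add_apply, Matrix.smul_apply, e1, e2]
      simp only [smul_eq_mul, Matrix.smul_mul, Matrix.one_mul, Matrix.smul_apply, conjTranspose_apply,
        replicateCol_apply, Pi.smul_apply, star_trivial, Matrix.zero_apply]
      have : b ⬝ᵥ β = c - s := by rw [hsdef]; ring
      rw [this]
      field_simp
      ring
    have h22 : (replicateCol (Fin 1) b)ᴴ * replicateCol (Fin 1) (-s⁻¹ • β) +
        (c • 1) * (s⁻¹ • (1 : Matrix (Fin 1) (Fin 1) ℝ)) = (1 : Matrix (Fin 1) (Fin 1) ℝ) := by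
      ext i j
      have e1 : ((replicateCol (Fin 1) b)ᴴ * replicateCol (Fin 1) (-s⁻¹ • β)) i j
          = -s⁻¹ * (b ⬝ᵥ β) := by
        rw [← smul_eq_mul, ← dotProduct_smul]
        simp [Matrix.mul_apply, dotProduct]
      rw [Matrix.add_apply, e1]
      have : b ⬝ᵥ β = c - s := by rw [hsdef]; ring
      rw [this]
      rw [Subsingleton.elim i j]
      simp
      field_simp
      ring
    rw [h11, h12, h21, h22, fromBlocks_one, submatrix_one_equiv]
  rw [hinv, borderedMatrix, borderedMatrix, submatrix_mul_equiv, fromBlocks_multiply]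
  have htr : ∀ M : Matrix (Fin r ⊕ Fin 1) (Fin r ⊕ Fin 1) ℝ,
      (M.submatrix finSumFinEquiv.symm finSumFinEquiv.symm).trace = M.trace := fun M => by
    simp only [trace, diag_apply, submatrix_apply]
    exact finSumFinEquiv.symm.sum_comp fun i => M i i
  have htr2 : ∀ (M : Matrix (Fin r) (Fin r) ℝ) (N O) (Q : Matrix (Fin 1) (Fin 1) ℝ),
      (fromBlocks M N O Q).trace = M.trace + Q.trace := fun M N O Q => by
    simp [trace]
  rw [htr, htr2, trace_add, trace_add, Matrix.mul_add, trace_add, Matrix.mul_smul,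
    trace_smul]
  have t1 : (Lᵀ * L * vecMulVec β β).trace = (L *ᵥ β) ⬝ᵥ (L *ᵥ β) := by
    rw [mul_vecMulVec, trace_vecMulVec, ← mulVec_mulVec, dotProduct_comm, dotProduct_mulVec,
      vecMul_transpose]
  have t2 : (replicateCol (Fin 1) (Lᵀ *ᵥ y) * (replicateCol (Fin 1) (-s⁻¹ • β))ᴴ).trace
      = -s⁻¹ * (y ⬝ᵥ (L *ᵥ β)) := by
    rw [dotProduct_mulVec, ← mulVec_transpose, ← smul_eq_mul, ← dotProduct_smul]
    simp [Matrix.trace, Matrix.mul_apply, dotProduct]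
  have t3 : ((replicateCol (Fin 1) (Lᵀ *ᵥ y))ᴴ * replicateCol (Fin 1) (-s⁻¹ • β)).trace
      = -s⁻¹ * (y ⬝ᵥ (L *ᵥ β)) := by
    rw [dotProduct_mulVec, ← mulVec_transpose, ← smul_eq_mul, ← dotProduct_smul]
    simp [Matrix.trace, Matrix.mul_apply, dotProduct]
  have t4 : (u • (1 : Matrix (Fin 1) (Fin 1) ℝ) * (s⁻¹ • (1 : Matrix (Fin 1) (Fin 1) ℝ))).trace
      = u * s⁻¹ := by simp [mul_comm]
  have t5 : ∑ i, (((L * A⁻¹) *ᵥ b) i - y i) ^ 2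
      = (L *ᵥ β) ⬝ᵥ (L *ᵥ β) - 2 * (y ⬝ᵥ (L *ᵥ β)) + y ⬝ᵥ y := by
    rw [hβ, mulVec_mulVec]
    simp only [dotProduct, Finset.mul_sum, ← Finset.sum_add_distrib, ← Finset.sum_sub_distrib]
    exact Finset.sum_congr rfl fun i _ => by ring
  rw [t1, t2, t3, t4, t5, smul_eq_mul]
  ring

lemma lintegral_exp_neg_mul_sum_sq {r : ℕ} {M : Matrix (Fin r) (Fin r) ℝ} (hM : M.det ≠ 0)
    (y : Fin r → ℝ) {κ : ℝ} (hκ : 0 < κ) :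
    ∫⁻ b : Fin r → ℝ, ENNReal.ofReal (Real.exp (-κ * ∑ i, ((M *ᵥ b) i - y i) ^ 2)) =
      ENNReal.ofReal (|M.det|⁻¹ * (π / κ) ^ ((r : ℝ) / 2)) := by
  have hprod : ∀ x : Fin r → ℝ,
      Real.exp (-κ * ∑ i, x i ^ 2) = ∏ i, Real.exp (-κ * x i ^ 2) := fun x => by
    rw [← Real.exp_sum, Finset.mul_sum]
  have hint : Integrable fun x : Fin r → ℝ => Real.exp (-κ * ∑ i, x i ^ 2) := by
    simp_rw [hprod]
    exact Integrable.fintype_prod (f := fun (_ : Fin r) t => Real.exp (-κ * t ^ 2))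
      fun _ => integrable_exp_neg_mul_sq hκ
  have hgauss : ∫⁻ x : Fin r → ℝ, ENNReal.ofReal (Real.exp (-κ * ∑ i, x i ^ 2)) =
      ENNReal.ofReal ((π / κ) ^ ((r : ℝ) / 2)) := by
    rw [← ofReal_integral_eq_lintegral_ofReal hint (ae_of_all _ fun _ => (Real.exp_pos _).le)]
    simp_rw [hprod]
    rw [integral_fintype_prod_volume_eq_pow (fun t : ℝ => Real.exp (-κ * t ^ 2)),
      integral_gaussian, Fintype.card_fin, Real.sqrt_eq_rpow, ← Real.rpow_natCast,
      ← Real.rpow_mul (by positivity)]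
    congr 2
    ring
  have hmeas : Measurable fun x : Fin r → ℝ =>
      ENNReal.ofReal (Real.exp (-κ * ∑ i, (x i - y i) ^ 2)) := by fun_prop
  have hlin : Measurable (toLin' M) := (toLin' M).continuous_of_finiteDimensional.measurable
  calc ∫⁻ b : Fin r → ℝ, ENNReal.ofReal (Real.exp (-κ * ∑ i, ((M *ᵥ b) i - y i) ^ 2))
      = ∫⁻ x, ENNReal.ofReal (Real.exp (-κ * ∑ i, (x i - y i) ^ 2))
          ∂(Measure.map (toLin' M) volume) := by
        rw [lintegral_map hmeas hlin]
        simp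
    _ = ENNReal.ofReal (|M.det|⁻¹) *
          ∫⁻ x : Fin r → ℝ, ENNReal.ofReal (Real.exp (-κ * ∑ i, (x i - y i) ^ 2)) := by
        rw [Real.map_matrix_volume_pi_eq_smul_volume_pi hM, lintegral_smul_measure, abs_inv,
          smul_eq_mul]
    _ = _ := by
        rw [ENNReal.ofReal_mul (by positivity), ← hgauss]
        congr 1
        exact lintegral_sub_right_eq_self
          (fun x : Fin r → ℝ => ENNReal.ofReal (Real.exp (-κ * ∑ i, x i ^ 2))) y

lemma lintegral_rpow_mul_exp_neg_div {a k : ℝ} (ha : 0 < a) (hk : 0 < k) :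
    ∫⁻ s in Set.Ioi (0 : ℝ), ENNReal.ofReal (s ^ (-a - 1) * Real.exp (-(k / s))) =
      ENNReal.ofReal (Real.Gamma a * k ^ (-a)) := by
  set g : ℝ → ℝ := fun t => t ^ (a - 1) * Real.exp (-(k * t)) with hg
  have hgint : ∫ t in Set.Ioi (0 : ℝ), g t = (1 / k) ^ a * Real.Gamma a :=
    Real.integral_rpow_mul_exp_neg_mul_Ioi ha hk
  have hgi : IntegrableOn g (Set.Ioi 0) := by
    refine not_imp_comm.1 integral_undef ?_
    rw [hgint]
    have := Real.Gamma_pos_of_pos ha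
    positivity
  have heq : Set.EqOn (fun s : ℝ => (|(-1 : ℝ)| * s ^ ((-1 : ℝ) - 1)) • g (s ^ (-1 : ℝ)))
      (fun s => s ^ (-a - 1) * Real.exp (-(k / s))) (Set.Ioi 0) := by
    intro s hs
    have hs : 0 < s := hs
    simp only [hg, abs_neg, abs_one, one_mul, smul_eq_mul]
    rw [← Real.rpow_mul hs.le, ← mul_assoc, ← Real.rpow_add hs, Real.rpow_neg_one, div_eq_mul_inv]
    congr 2
    ring
  have hint := (integrableOn_Ioi_comp_rpow_iff g (p := -1) (by norm_num)).2 hgi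
  have hval := integral_comp_rpow_Ioi g (p := -1) (by norm_num)
  rw [integrableOn_congr_fun heq measurableSet_Ioi] at hint
  rw [setIntegral_congr_fun measurableSet_Ioi heq, hgint] at hval
  rw [← ofReal_integral_eq_lintegral_ofReal hint, hval, one_div, Real.inv_rpow hk.le,
    Real.rpow_neg hk.le, mul_comm]
  filter_upwards [self_mem_ae_restrict measurableSet_Ioi] with s hs
  have : 0 < s := hs
  positivity

lemma isHermitian_lowerToSym {r : ℕ} (w : {q : Fin r × Fin r // q.2 ≤ q.1} → ℝ) :
    (lowerToSym w).IsHermitian := by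
  ext i j
  simp only [conjTranspose_apply, lowerToSym, of_apply, star_trivial]
  rcases lt_trichotomy i j with h | h | h
  · rw [dif_pos h.le, dif_neg (not_le.2 h)]
  · subst h; rfl
  · rw [dif_neg (not_le.2 h), dif_pos h.le]

lemma continuous_lowerToSym (r : ℕ) :
    Continuous (lowerToSym : ({q : Fin r × Fin r // q.2 ≤ q.1} → ℝ) → _) := by
  refine continuous_matrix fun i j => ?_
  simp only [lowerToSym, of_apply]
  split_ifs <;> exact continuous_apply _

lemma measurable_det_lowerToSym (r : ℕ) :
    Measurable fun w : {q : Fin r × Fin r // q.2 ≤ q.1} → ℝ => (lowerToSym w).det :=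
  (continuous_lowerToSym r).matrix_det.measurable

lemma measurableSet_posDef_lowerToSym (r : ℕ) :
    MeasurableSet {w : {q : Fin r × Fin r // q.2 ≤ q.1} → ℝ | (lowerToSym w).PosDef} := by
  have hset : {w : {q : Fin r × Fin r // q.2 ≤ q.1} → ℝ | (lowerToSym w).PosDef} =
      (⋂ x : Fin r → ℝ, {w | 0 ≤ x ⬝ᵥ (lowerToSym w *ᵥ x)}) ∩ {w | (lowerToSym w).det ≠ 0} := by
    ext w
    simp only [Set.mem_ofPred_eq, Set.mem_inter_iff, Set.mem_iInter]
    constructor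
    · intro h
      refine ⟨fun x => ?_, h.det_pos.ne'⟩
      simpa using (posSemidef_iff_dotProduct_mulVec.1 h.posSemidef).2 x
    · rintro ⟨h1, h2⟩
      have hps : (lowerToSym w).PosSemidef :=
        .of_dotProduct_mulVec_nonneg (isHermitian_lowerToSym w) fun x => by simpa using h1 x
      refine hps.posDef_iff_isUnit.2 ?_
      rw [isUnit_iff_isUnit_det]
      exact h2.isUnit
  rw [hset]
  refine (isClosed_iInter fun x => isClosed_le continuous_const ?_).measurableSet.inter
    ((measurableSet_singleton 0).compl.preimage (measurable_det_lowerToSym r))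
  exact Continuous.dotProduct continuous_const
    ((continuous_lowerToSym r).matrix_mulVec continuous_const)

lemma measurable_trace_mul_inv_lowerToSym {r : ℕ} (S : Matrix (Fin r) (Fin r) ℝ) :
    Measurable fun w : {q : Fin r × Fin r // q.2 ≤ q.1} → ℝ => (S * (lowerToSym w)⁻¹).trace := by
  simp_rw [Matrix.inv_def, Ring.inverse_eq_inv', Matrix.mul_smul, trace_smul, smul_eq_mul]
  exact (measurable_det_lowerToSym r).inv.mul
    (continuous_const.matrix_mul (continuous_lowerToSym r).matrix_adjugate).matrix_trace.measurable

/-- The on-and-below-diagonal positions of an `(r + 1) × (r + 1)` matrix are those of its leading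
`r × r` block together with the positions of its last row. -/
noncomputable def lowerIndexEquiv (r : ℕ) :
    {q : Fin r × Fin r // q.2 ≤ q.1} ⊕ (Fin r ⊕ Unit) ≃
      {q : Fin (r + 1) × Fin (r + 1) // q.2 ≤ q.1} :=
  Equiv.ofBijective
    (Sum.elim (fun q => ⟨(q.1.1.castSucc, q.1.2.castSucc), Fin.castSucc_le_castSucc_iff.2 q.2⟩)
      (Sum.elim (fun j => ⟨(Fin.last r, j.castSucc), Fin.le_last _⟩)
        fun _ => ⟨(Fin.last r, Fin.last r), le_rfl⟩))
    (by
      constructor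
      · rintro (⟨⟨i, j⟩, h⟩ | j | _) (⟨⟨i', j'⟩, h'⟩ | j' | _) heq <;>
          simp_all [Fin.ext_iff] <;> omega
      · rintro ⟨⟨i, j⟩, h⟩
        induction i using Fin.lastCases with
        | last =>
          induction j using Fin.lastCases with
          | last => exact ⟨.inr (.inr ()), rfl⟩
          | cast j => exact ⟨.inr (.inl j), rfl⟩
        | cast i =>
          induction j using Fin.lastCases with
          | last => exact absurd h (not_le.2 (Fin.castSucc_lt_last i))
          | cast j => exact ⟨.inl ⟨(i, j), Fin.castSucc_le_castSucc_iff.1 h⟩, rfl⟩)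

/-- Assemble the on-and-below-diagonal entries of a bordered matrix. -/
noncomputable def lowerJoin (r : ℕ) :
    ({q : Fin r × Fin r // q.2 ≤ q.1} → ℝ) × (Fin r → ℝ) × ℝ ≃ᵐ
      ({q : Fin (r + 1) × Fin (r + 1) // q.2 ≤ q.1} → ℝ) :=
  (MeasurableEquiv.prodCongr (MeasurableEquiv.refl _)
    ((MeasurableEquiv.prodCongr (MeasurableEquiv.refl _)
      (MeasurableEquiv.funUnique Unit ℝ).symm).trans
        (MeasurableEquiv.sumPiEquivProdPi fun _ : Fin r ⊕ Unit => ℝ).symm)).trans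
    ((MeasurableEquiv.sumPiEquivProdPi
      fun _ : {q : Fin r × Fin r // q.2 ≤ q.1} ⊕ (Fin r ⊕ Unit) => ℝ).symm.trans
        (MeasurableEquiv.piCongrLeft (fun _ => ℝ) (lowerIndexEquiv r)))

lemma measurePreserving_lowerJoin (r : ℕ) : MeasurePreserving (lowerJoin r) := by
  refine MeasurePreserving.trans (MeasurePreserving.prod (MeasurePreserving.id _)
    (MeasurePreserving.trans (MeasurePreserving.prod (MeasurePreserving.id _)
      (volume_preserving_funUnique Unit ℝ).symm)
      (volume_measurePreserving_sumPiEquivProdPi_symm fun _ : Fin r ⊕ Unit => ℝ))) ?_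
  exact MeasurePreserving.trans (volume_measurePreserving_sumPiEquivProdPi_symm
    fun _ : {q : Fin r × Fin r // q.2 ≤ q.1} ⊕ (Fin r ⊕ Unit) => ℝ)
    (volume_measurePreserving_piCongrLeft (fun _ => ℝ) (lowerIndexEquiv r))

lemma lowerJoin_apply {r : ℕ} (w : {q : Fin r × Fin r // q.2 ≤ q.1} → ℝ) (b : Fin r → ℝ) (c : ℝ)
    (i : {q : Fin r × Fin r // q.2 ≤ q.1} ⊕ (Fin r ⊕ Unit)) :
    lowerJoin r (w, b, c) (lowerIndexEquiv r i) = Sum.elim w (Sum.elim b fun _ => c) i := by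
  have : lowerJoin r (w, b, c) = Equiv.piCongrLeft (fun _ => ℝ) (lowerIndexEquiv r)
      (Sum.elim w (Sum.elim b fun _ => c)) := by
    rw [lowerJoin]
    simp only [MeasurableEquiv.trans_apply, MeasurableEquiv.coe_piCongrLeft]
    rfl
  rw [this, Equiv.piCongrLeft_apply_apply]

lemma lowerToSym_lowerJoin {r : ℕ} (w : {q : Fin r × Fin r // q.2 ≤ q.1} → ℝ) (b : Fin r → ℝ)
    (c : ℝ) : lowerToSym (lowerJoin r (w, b, c)) = borderedMatrix (lowerToSym w) b c := by
  rw [eq_borderedMatrix (isHermitian_lowerToSym (lowerJoin r (w, b, c)))]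
  congr 1
  · ext i j
    simp only [lowerToSym, submatrix_apply, of_apply, Fin.castSucc_le_castSucc_iff]
    split_ifs with h
    · exact lowerJoin_apply w b c (.inl ⟨(i, j), h⟩)
    · exact lowerJoin_apply w b c (.inl ⟨(j, i), (not_le.1 h).le⟩)
  · ext i
    simp only [lowerToSym, of_apply]
    rw [dif_neg (not_le.2 (Fin.castSucc_lt_last i))]
    exact lowerJoin_apply w b c (.inr (.inl i))
  · simp only [lowerToSym, of_apply]
    rw [dif_pos le_rfl]
    exact lowerJoin_apply w b c (.inr (.inr ()))

/-- The unnormalised inverse Wishart density with `2a` degrees of freedom, extended by zero to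
matrices that are not positive definite. -/
noncomputable def invWishartKernel {r : ℕ} (a : ℝ) (S : Matrix (Fin r) (Fin r) ℝ) :
    Matrix (Fin r) (Fin r) ℝ → ℝ :=
  Set.indicator {D | D.PosDef}
    fun D => D.det ^ (-a - ((r : ℝ) + 1) / 2) * Real.exp (-(1 / 2) * (S * D⁻¹).trace)

lemma invWishartKernel_of_posDef {r : ℕ} (a : ℝ) (S : Matrix (Fin r) (Fin r) ℝ)
    {D : Matrix (Fin r) (Fin r) ℝ} (hD : D.PosDef) : invWishartKernel a S D =
      D.det ^ (-a - ((r : ℝ) + 1) / 2) * Real.exp (-(1 / 2) * (S * D⁻¹).trace) :=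
  Set.indicator_of_mem (s := {D : Matrix (Fin r) (Fin r) ℝ | D.PosDef}) hD _

lemma invWishartKernel_of_not_posDef {r : ℕ} (a : ℝ) (S : Matrix (Fin r) (Fin r) ℝ)
    {D : Matrix (Fin r) (Fin r) ℝ} (hD : ¬ D.PosDef) : invWishartKernel a S D = 0 :=
  Set.indicator_of_notMem (s := {D : Matrix (Fin r) (Fin r) ℝ | D.PosDef}) hD _

lemma invWishartKernel_nonneg {r : ℕ} (a : ℝ) (S D : Matrix (Fin r) (Fin r) ℝ) :
    0 ≤ invWishartKernel a S D := by
  refine Set.indicator_nonneg (fun D hD => ?_) D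
  have : 0 < D.det := PosDef.det_pos hD
  positivity

lemma measurable_invWishartKernel_lowerToSym {r : ℕ} (a : ℝ) (S : Matrix (Fin r) (Fin r) ℝ) :
    Measurable fun w => invWishartKernel a S (lowerToSym w) := by
  have : (fun w => invWishartKernel a S (lowerToSym w)) =
      Set.indicator {w | (lowerToSym w).PosDef} fun w => (lowerToSym w).det ^
        (-a - ((r : ℝ) + 1) / 2) * Real.exp (-(1 / 2) * (S * (lowerToSym w)⁻¹).trace) := rfl
  rw [this]
  exact (((measurable_det_lowerToSym r).pow_const _).mul
    ((measurable_trace_mul_inv_lowerToSym S).const_mul _).exp).indicator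
      (measurableSet_posDef_lowerToSym r)

/-- Integrating the kernel over the last row of a positive definite matrix with prescribed leading
block `A`. -/
lemma lintegral_invWishartKernel_borderedMatrix {r : ℕ} {a : ℝ} (ha : 0 < a)
    {L : Matrix (Fin r) (Fin r) ℝ} (hL : L.det ≠ 0) {y : Fin r → ℝ} {u : ℝ} (hu : 0 < u - y ⬝ᵥ y)
    {A : Matrix (Fin r) (Fin r) ℝ} (hA : A.PosDef) :
    ∫⁻ b : Fin r → ℝ, ∫⁻ c : ℝ, ENNReal.ofReal
        (invWishartKernel a (borderedMatrix (Lᵀ * L) (Lᵀ *ᵥ y) u) (borderedMatrix A b c)) =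
      ENNReal.ofReal (|L.det|⁻¹ * (2 * π) ^ ((r : ℝ) / 2) *
          (Real.Gamma a * ((u - y ⬝ᵥ y) / 2) ^ (-a))) *
        ENNReal.ofReal (invWishartKernel (a - 1 / 2) (Lᵀ * L) A) := by
  set k := u - y ⬝ᵥ y with hk
  set T := (Lᵀ * L * A⁻¹).trace with hT
  set d := A.det with hd
  have hd0 : 0 < d := hA.det_pos
  set e : ℝ := -a - (((r + 1 : ℕ) : ℝ) + 1) / 2 with he
  set Q : (Fin r → ℝ) → ℝ := fun b => ∑ i, (((L * A⁻¹) *ᵥ b) i - y i) ^ 2 with hQ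
  have hQm : Measurable Q := by
    have : Continuous Q := by
      have : Continuous fun b => (L * A⁻¹) *ᵥ b := continuous_const.matrix_mulVec continuous_id
      fun_prop
    exact this.measurable
  set H : (Fin r → ℝ) → ℝ → ENNReal := fun b s =>
    ENNReal.ofReal ((d * s) ^ e * Real.exp (-(1 / 2) * (T + s⁻¹ * (Q b + k)))) with hH
  have hinner : ∀ b : Fin r → ℝ, ∫⁻ c : ℝ, ENNReal.ofReal
      (invWishartKernel a (borderedMatrix (Lᵀ * L) (Lᵀ *ᵥ y) u) (borderedMatrix A b c)) =
      ∫⁻ s in Set.Ioi (0 : ℝ), H b s := by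
    intro b
    rw [← lintegral_indicator measurableSet_Ioi,
      ← lintegral_sub_right_eq_self ((Set.Ioi 0).indicator (H b)) (b ⬝ᵥ A⁻¹ *ᵥ b)]
    refine lintegral_congr fun c => ?_
    by_cases hc : 0 < c - b ⬝ᵥ A⁻¹ *ᵥ b
    · have hpd := (posDef_borderedMatrix_iff hA b c).2 hc
      rw [Set.indicator_of_mem (Set.mem_Ioi.2 hc), invWishartKernel_of_posDef a _ hpd,
        det_borderedMatrix hd0.ne', trace_borderedMatrix_mul_inv hA b c hc]
    · have hpd := mt (posDef_borderedMatrix_iff hA b c).1 hc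
      rw [Set.indicator_of_notMem (by simpa using hc), invWishartKernel_of_not_posDef a _ hpd,
        ENNReal.ofReal_zero]
  simp_rw [hinner]
  rw [lintegral_lintegral_swap]
  · have hdet : (L * A⁻¹).det ≠ 0 := by
      rw [det_mul, det_nonsing_inv, Ring.inverse_eq_inv']
      exact mul_ne_zero hL (inv_ne_zero hd0.ne')
    have hdetabs : |(L * A⁻¹).det|⁻¹ = |L.det|⁻¹ * d := by
      rw [det_mul, det_nonsing_inv, Ring.inverse_eq_inv', abs_mul, abs_inv, abs_of_pos hd0,
        mul_inv, inv_inv]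
    set C : ℝ := d ^ (-(a - 1 / 2) - ((r : ℝ) + 1) / 2) * Real.exp (-(1 / 2) * T) *
      (|L.det|⁻¹ * (2 * π) ^ ((r : ℝ) / 2)) with hC
    have hC0 : 0 ≤ C := by positivity
    have hb : ∀ s ∈ Set.Ioi (0 : ℝ), ∫⁻ b, H b s =
        ENNReal.ofReal C * ENNReal.ofReal (s ^ (-a - 1) * Real.exp (-(k / 2 / s))) := by
      intro s hs
      have hs : 0 < s := hs
      have hHs : ∀ b, H b s = ENNReal.ofReal ((d * s) ^ e * Real.exp (-(1 / 2) * T) *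
          Real.exp (-(k / 2 / s))) * ENNReal.ofReal (Real.exp (-(1 / (2 * s)) * Q b)) := by
        intro b
        rw [← ENNReal.ofReal_mul (by positivity), hH]
        simp only [mul_assoc, ← Real.exp_add]
        congr 3
        field_simp
        ring
      simp_rw [hHs]
      rw [lintegral_const_mul _ (by fun_prop), lintegral_exp_neg_mul_sum_sq hdet y (by positivity),
        ← ENNReal.ofReal_mul (by positivity), ← ENNReal.ofReal_mul hC0, hdetabs, hC]
      congr 1
      have h1 : (π / (1 / (2 * s))) ^ ((r : ℝ) / 2) =
          (2 * π) ^ ((r : ℝ) / 2) * s ^ ((r : ℝ) / 2) := by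
        rw [← Real.mul_rpow (by positivity) hs.le]
        congr 1
        field_simp
      have h2 : d ^ (-(a - 1 / 2) - ((r : ℝ) + 1) / 2) = d ^ e * d := by
        rw [← Real.rpow_add_one hd0.ne']
        congr 1
        rw [he]; push_cast; ring
      have h3 : s ^ (-a - 1) = s ^ e * s ^ ((r : ℝ) / 2) := by
        rw [← Real.rpow_add hs]
        congr 1
        rw [he]; push_cast; ring
      rw [h1, h2, h3, Real.mul_rpow hd0.le hs.le]
      ring
    rw [setLIntegral_congr_fun measurableSet_Ioi hb, lintegral_const_mul _ (by fun_prop),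
      lintegral_rpow_mul_exp_neg_div ha (by positivity), ← ENNReal.ofReal_mul hC0,
      ← ENNReal.ofReal_mul (by have := Real.Gamma_pos_of_pos ha; positivity),
      invWishartKernel_of_posDef _ _ hA, hC]
    congr 1
    ring
  · refine Measurable.aemeasurable ?_
    simp only [hH, Function.uncurry_def]
    fun_prop

lemma multivariateGamma_succ (r : ℕ) (a : ℝ) :
    multivariateGamma (r + 1) a =
      π ^ ((r : ℝ) / 2) * Real.Gamma a * multivariateGamma r (a - 1 / 2) := by
  have hprod : ∏ l ∈ Finset.Icc 1 (r + 1), Real.Gamma (a + (1 - (l : ℝ)) / 2) =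
      Real.Gamma a * ∏ l ∈ Finset.Icc 1 r, Real.Gamma (a - 1 / 2 + (1 - (l : ℝ)) / 2) := by
    simp only [← Finset.Ico_add_one_right_eq_Icc, Finset.prod_Ico_eq_prod_range,
      Nat.add_sub_cancel]
    rw [Finset.prod_range_succ', mul_comm]
    congr 1
    · simp
    · refine Finset.prod_congr rfl fun i _ => ?_
      congr 1
      push_cast
      ring
  rw [multivariateGamma, multivariateGamma, hprod]
  have hpi : π ^ (((r + 1 : ℕ) : ℝ) * (((r + 1 : ℕ) : ℝ) - 1) / 4) =
      π ^ ((r : ℝ) / 2) * π ^ ((r : ℝ) * ((r : ℝ) - 1) / 4) := by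
    rw [← Real.rpow_add Real.pi_pos]
    congr 1
    push_cast
    ring
  rw [hpi]
  ring

lemma multivariateGamma_pos {r : ℕ} {a : ℝ} (ha : ((r : ℝ) - 1) / 2 < a) :
    0 < multivariateGamma r a := by
  refine mul_pos (Real.rpow_pos_of_pos Real.pi_pos _) (Finset.prod_pos fun l hl => ?_)
  have : (l : ℝ) ≤ r := by exact_mod_cast (Finset.mem_Icc.1 hl).2
  exact Real.Gamma_pos_of_pos (by linarith)

open scoped MatrixOrder in
theorem exists_eq_transpose_mul_self {n : Type*} [Fintype n] [DecidableEq n] {P : Matrix n n ℝ}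
    (hP : P.PosSemidef) : ∃ L : Matrix n n ℝ, P = Lᵀ * L := by
  obtain ⟨L, hL⟩ := CStarAlgebra.nonneg_iff_eq_star_mul_self.mp hP.nonneg
  exact ⟨L, by simpa [star_eq_conjTranspose] using hL⟩

/-- The normalising constant of the inverse Wishart distribution. -/
theorem lintegral_invWishartKernel {r : ℕ} {a : ℝ} (ha : ((r : ℝ) - 1) / 2 < a)
    {S : Matrix (Fin r) (Fin r) ℝ} (hS : S.PosDef) :
    ∫⁻ w, ENNReal.ofReal (invWishartKernel a S (lowerToSym w)) =
      ENNReal.ofReal (multivariateGamma r a * 2 ^ (a * r) * S.det ^ (-a)) := by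
  induction r generalizing a with
  | zero =>
    have h1 : ∀ w, invWishartKernel a S (lowerToSym w) = 1 := fun w => by
      have hpd : (lowerToSym w).PosDef := by
        rw [Subsingleton.elim (lowerToSym w) 1]
        exact PosDef.one
      rw [invWishartKernel_of_posDef a S hpd]
      simp [Matrix.trace]
    simp only [h1]
    simp [multivariateGamma, volume_pi]
  | succ r ih =>
    have hr : (0 : ℝ) ≤ r := r.cast_nonneg
    push_cast at ha
    have ha0 : 0 < a := by linarith
    set P := S.submatrix Fin.castSucc Fin.castSucc with hP
    have hPpd : P.PosDef := hS.submatrix (Fin.castSucc_injective r)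
    obtain ⟨L, hL⟩ := exists_eq_transpose_mul_self hPpd.posSemidef
    have hPdet : P.det = |L.det| ^ 2 := by
      rw [hL, det_mul, det_transpose, sq_abs, sq]
    have hLdet : L.det ≠ 0 := fun h => by
      have := hPpd.det_pos
      rw [hPdet, h] at this
      simp at this
    set u := S (Fin.last r) (Fin.last r)
    set y := (Lᵀ)⁻¹ *ᵥ fun i => S i.castSucc (Fin.last r) with hy
    have hSeq : S = borderedMatrix (Lᵀ * L) (Lᵀ *ᵥ y) u := by
      rw [hy, mulVec_mulVec, mul_nonsing_inv _ (by rw [det_transpose]; exact hLdet.isUnit),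
        one_mulVec, ← hL]
      exact eq_borderedMatrix hS.1
    have hSdet : S.det = P.det * (u - y ⬝ᵥ y) := by
      conv_lhs => rw [hSeq]
      rw [← hL, det_borderedMatrix hPpd.det_pos.ne']
      congr 2
      rw [hL, Matrix.mul_inv_rev, ← mulVec_mulVec, mulVec_mulVec _ (Lᵀ)⁻¹, nonsing_inv_mul _
        (by rw [det_transpose]; exact hLdet.isUnit), one_mulVec, mulVec_transpose,
        ← dotProduct_mulVec, mulVec_mulVec, mul_nonsing_inv _ hLdet.isUnit, one_mulVec]
    have hk : 0 < u - y ⬝ᵥ y := by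
      have := hS.det_pos
      rw [hSdet] at this
      exact (mul_pos_iff_of_pos_left hPpd.det_pos).1 this
    have hmeas : Measurable fun p => ENNReal.ofReal
        (invWishartKernel a S (lowerToSym (lowerJoin r p))) :=
      (measurable_invWishartKernel_lowerToSym a S).ennreal_ofReal.comp (lowerJoin r).measurable
    rw [(measurePreserving_lowerJoin r).lintegral_map_equiv, Measure.volume_eq_prod,
      lintegral_prod _ hmeas.aemeasurable]
    have hstep : ∀ w : {q : Fin r × Fin r // q.2 ≤ q.1} → ℝ,
        ∫⁻ p : (Fin r → ℝ) × ℝ, ENNReal.ofReal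
          (invWishartKernel a S (lowerToSym (lowerJoin r (w, p)))) =
        ENNReal.ofReal (|L.det|⁻¹ * (2 * π) ^ ((r : ℝ) / 2) *
          (Real.Gamma a * ((u - y ⬝ᵥ y) / 2) ^ (-a))) *
        ENNReal.ofReal (invWishartKernel (a - 1 / 2) P (lowerToSym w)) := by
      intro w
      have hmeas_w : Measurable fun p => ENNReal.ofReal
          (invWishartKernel a S (lowerToSym (lowerJoin r (w, p)))) :=
        hmeas.comp measurable_prodMk_left
      rw [Measure.volume_eq_prod, lintegral_prod _ hmeas_w.aemeasurable]
      simp_rw [lowerToSym_lowerJoin]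
      by_cases hw : (lowerToSym w).PosDef
      · rw [hSeq, lintegral_invWishartKernel_borderedMatrix ha0 hLdet hk hw, ← hL]
      · have h0 : ∀ b c, invWishartKernel a S (borderedMatrix (lowerToSym w) b c) = 0 :=
          fun b c => invWishartKernel_of_not_posDef a S fun h =>
            hw (posDef_of_posDef_borderedMatrix h)
        have h0' : invWishartKernel (a - 1 / 2) P (lowerToSym w) = 0 :=
          invWishartKernel_of_not_posDef _ _ hw
        rw [h0']
        simp [h0]
    simp_rw [hstep]
    have hG := Real.Gamma_pos_of_pos ha0
    rw [lintegral_const_mul _ (measurable_invWishartKernel_lowerToSym _ _).ennreal_ofReal,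
      ih (by linarith) hPpd, ← ENNReal.ofReal_mul (by positivity), multivariateGamma_succ, hSdet]
    congr 1
    have hPp := hPpd.det_pos
    have hLP : |L.det|⁻¹ = P.det ^ (-(1 / 2) : ℝ) := by
      rw [hPdet, Real.rpow_neg (by positivity), ← Real.sqrt_eq_rpow, Real.sqrt_sq (abs_nonneg _)]
    have hP2 : P.det ^ (-a) = P.det ^ (-(1 / 2) : ℝ) * P.det ^ (-(a - 1 / 2)) := by
      rw [← Real.rpow_add hPp]
      congr 1
      ring
    have h2 : (2 : ℝ) ^ (a * ((r + 1 : ℕ) : ℝ)) =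
        2 ^ ((r : ℝ) / 2) * 2 ^ ((a - 1 / 2) * (r : ℝ)) * 2 ^ a := by
      rw [← Real.rpow_add two_pos, ← Real.rpow_add two_pos]
      congr 1
      push_cast
      ring
    rw [hLP, Real.mul_rpow hPp.le hk.le, hP2, h2, Real.mul_rpow two_pos.le Real.pi_pos.le,
      Real.div_rpow hk.le two_pos.le, Real.rpow_neg two_pos.le, div_inv_eq_mul]
    ring

theorem invWishartKernel_mul_exp_mul_log_det {r : ℕ} (a t : ℝ) (S D : Matrix (Fin r) (Fin r) ℝ) :
    invWishartKernel a S D * Real.exp (t * Real.log D.det) = invWishartKernel (a - t) S D := by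
  by_cases hD : D.PosDef
  · have hd := hD.det_pos
    rw [invWishartKernel_of_posDef _ _ hD, invWishartKernel_of_posDef _ _ hD, mul_comm t,
      ← Real.rpow_def_of_pos hd, mul_right_comm, ← Real.rpow_add hd]
    congr 2
    ring
  · rw [invWishartKernel_of_not_posDef _ _ hD, invWishartKernel_of_not_posDef _ _ hD, zero_mul]

theorem integrable_invWishartKernel {r : ℕ} {a : ℝ} (ha : ((r : ℝ) - 1) / 2 < a)
    {S : Matrix (Fin r) (Fin r) ℝ} (hS : S.PosDef) :
    Integrable fun w => invWishartKernel a S (lowerToSym w) := by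
  rw [← lintegral_ofReal_ne_top_iff_integrable
    (measurable_invWishartKernel_lowerToSym a S).aestronglyMeasurable
    (ae_of_all _ fun w => invWishartKernel_nonneg a S _), lintegral_invWishartKernel ha hS]
  exact ENNReal.ofReal_ne_top

theorem integral_invWishartKernel {r : ℕ} {a : ℝ} (ha : ((r : ℝ) - 1) / 2 < a)
    {S : Matrix (Fin r) (Fin r) ℝ} (hS : S.PosDef) :
    ∫ w, invWishartKernel a S (lowerToSym w) =
      multivariateGamma r a * 2 ^ (a * r) * S.det ^ (-a) := by
  have hG := multivariateGamma_pos ha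
  have hd := hS.det_pos
  rw [integral_eq_lintegral_of_nonneg_ae (ae_of_all _ fun w => invWishartKernel_nonneg a S _)
    (measurable_invWishartKernel_lowerToSym a S).aestronglyMeasurable,
    lintegral_invWishartKernel ha hS, ENNReal.toReal_ofReal (by positivity)]

theorem hasDerivAt_multivariateGamma {r : ℕ} {a : ℝ} (ha : ((r : ℝ) - 1) / 2 < a) :
    HasDerivAt (multivariateGamma r)
      (multivariateGamma r a * ∑ l ∈ Finset.Icc 1 r, digamma (a + (1 - (l : ℝ)) / 2)) a := by
  have hpos : ∀ l ∈ Finset.Icc 1 r, 0 < a + (1 - (l : ℝ)) / 2 := fun l hl => by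
    have : (l : ℝ) ≤ r := by exact_mod_cast (Finset.mem_Icc.1 hl).2
    linarith
  have hl : ∀ l ∈ Finset.Icc 1 r, HasDerivAt (fun x : ℝ => Real.Gamma (x + (1 - (l : ℝ)) / 2))
      (Real.Gamma (a + (1 - (l : ℝ)) / 2) * digamma (a + (1 - (l : ℝ)) / 2)) a := fun l hl => by
    have hx := hpos l hl
    have hG := Real.Gamma_pos_of_pos hx
    have hd : DifferentiableAt ℝ Real.Gamma (a + (1 - (l : ℝ)) / 2) :=
      Real.differentiableAt_Gamma fun m => by
        have : (0 : ℝ) ≤ m := m.cast_nonneg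
        linarith
    have hdig : digamma (a + (1 - (l : ℝ)) / 2) =
        deriv Real.Gamma (a + (1 - (l : ℝ)) / 2) / Real.Gamma (a + (1 - (l : ℝ)) / 2) :=
      deriv.log hd hG.ne'
    rw [hdig, mul_div_cancel₀ _ hG.ne']
    exact hd.hasDerivAt.comp_add_const a _
  have := (HasDerivAt.fun_finsetProd hl).const_mul (Real.pi ^ ((r : ℝ) * ((r : ℝ) - 1) / 4))
  refine this.congr_deriv ?_
  rw [multivariateGamma, mul_assoc]
  congr 1
  rw [Finset.mul_sum]
  refine Finset.sum_congr rfl fun l hl => ?_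
  rw [smul_eq_mul, ← mul_assoc, Finset.prod_erase_mul (Finset.Icc 1 r)
    (fun l : ℕ => Real.Gamma (a + (1 - (l : ℝ)) / 2)) hl]

theorem hasDerivAt_invWishartNormalizer {r : ℕ} {a : ℝ} (ha : ((r : ℝ) - 1) / 2 < a)
    {d : ℝ} (hd : 0 < d) :
    HasDerivAt (fun x : ℝ => multivariateGamma r x * 2 ^ (x * r) * d ^ (-x))
      (multivariateGamma r a * 2 ^ (a * r) * d ^ (-a) *
        (∑ l ∈ Finset.Icc 1 r, digamma (a + (1 - (l : ℝ)) / 2) + r * Real.log 2 -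
          Real.log d)) a := by
  have h2 : HasDerivAt (fun x : ℝ => (2 : ℝ) ^ (x * r)) _ a :=
    ((hasDerivAt_id a).mul_const (r : ℝ)).const_rpow two_pos
  have h3 : HasDerivAt (fun x : ℝ => d ^ (-x)) _ a := (hasDerivAt_id a).neg.const_rpow hd
  refine (((hasDerivAt_multivariateGamma ha).mul h2).mul h3).congr_deriv ?_
  simp only [Pi.mul_apply]
  ring

open ProbabilityTheory in
theorem integral_invWishartKernel_mul_log_det {r : ℕ} {a : ℝ} (ha : ((r : ℝ) - 1) / 2 < a)
    {S : Matrix (Fin r) (Fin r) ℝ} (hS : S.PosDef) :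
    ∫ w, invWishartKernel a S (lowerToSym w) * Real.log (lowerToSym w).det =
      multivariateGamma r a * 2 ^ (a * r) * S.det ^ (-a) *
        (Real.log S.det - ∑ l ∈ Finset.Icc 1 r, digamma (a + (1 - (l : ℝ)) / 2) -
          r * Real.log 2) := by
  set X : ({q : Fin r × Fin r // q.2 ≤ q.1} → ℝ) → ℝ := fun w => Real.log (lowerToSym w).det
    with hX
  set μ : Measure ({q : Fin r × Fin r // q.2 ≤ q.1} → ℝ) :=
    volume.withDensity fun w => ENNReal.ofReal (invWishartKernel a S (lowerToSym w)) with hμ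
  have hmeas := (measurable_invWishartKernel_lowerToSym a S).ennreal_ofReal
  have hfin : ∀ᵐ w, ENNReal.ofReal (invWishartKernel a S (lowerToSym w)) < ⊤ :=
    ae_of_all _ fun w => ENNReal.ofReal_lt_top
  have htilt : ∀ t w, (ENNReal.ofReal (invWishartKernel a S (lowerToSym w))).toReal •
      Real.exp (t * X w) = invWishartKernel (a - t) S (lowerToSym w) := fun t w => by
    rw [ENNReal.toReal_ofReal (invWishartKernel_nonneg _ _ _), smul_eq_mul,
      invWishartKernel_mul_exp_mul_log_det]
  set U := Set.Iio (a - ((r : ℝ) - 1) / 2)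
  have hU : U ∈ nhds (0 : ℝ) := isOpen_Iio.mem_nhds (sub_pos.2 ha)
  have hexp : U ⊆ integrableExpSet X μ := fun t ht => by
    have ht' : ((r : ℝ) - 1) / 2 < a - t := by
      have : t < a - ((r : ℝ) - 1) / 2 := ht
      linarith
    change Integrable _ μ
    rw [hμ, integrable_withDensity_iff_integrable_smul' hmeas hfin]
    simp only [htilt]
    exact integrable_invWishartKernel ht' hS
  have hmgf : mgf X μ =ᶠ[nhds 0] fun t =>
      multivariateGamma r (a - t) * 2 ^ ((a - t) * r) * S.det ^ (-(a - t)) := by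
    filter_upwards [hU] with t ht
    have ht' : ((r : ℝ) - 1) / 2 < a - t := by
      have : t < a - ((r : ℝ) - 1) / 2 := ht
      linarith
    rw [mgf, hμ, integral_withDensity_eq_integral_toReal_smul hmeas hfin]
    simp only [htilt]
    exact integral_invWishartKernel ht' hS
  have hderiv := hasDerivAt_mgf (mem_interior_iff_mem_nhds.2 (Filter.mem_of_superset hU hexp))
  have hderiv' := (hasDerivAt_invWishartNormalizer (a := a - 0) (by simpa using ha)
    hS.det_pos).comp_const_sub a 0
  have huniq := hderiv.unique (hderiv'.congr_of_eventuallyEq hmgf)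
  rw [hμ, integral_withDensity_eq_integral_toReal_smul hmeas hfin] at huniq
  simp only [zero_mul, Real.exp_zero, mul_one, sub_zero, smul_eq_mul,
    ENNReal.toReal_ofReal (invWishartKernel_nonneg _ _ _)] at huniq
  rw [huniq]
  ring

/-- **Lemma 2, first part:** for `ν > r - 1` and `S` symmetric positive definite,
`∫ p_IW(D; ν, S) log det D dD = log det S - ∑_{l=1}^r ψ((ν-l+1)/2) - r log 2`,
the integral being over the cone of symmetric positive definite matrices. -/
theorem invWishart_expected_logdet {r : ℕ} (hr : 1 ≤ r) (ν : ℝ) (hν : (r : ℝ) - 1 < ν)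
    (S : Matrix (Fin r) (Fin r) ℝ) (hS : S.PosDef) :
    spdIntegral r (fun D => invWishartDensity r ν S D * Real.log D.det) =
      Real.log S.det - ∑ l ∈ Finset.Icc 1 r, digamma ((ν - (l : ℝ) + 1) / 2)
        - (r : ℝ) * Real.log 2 := by
  have ha : ((r : ℝ) - 1) / 2 < ν / 2 := by linarith
  have hG := multivariateGamma_pos ha
  have hd := hS.det_pos
  set c := multivariateGamma r (ν / 2) * 2 ^ (ν / 2 * r) * S.det ^ (-(ν / 2)) with hc
  have hc0 : c ≠ 0 := by positivity
  have hint : ∀ v : {q : Fin r × Fin r // q.2 ≤ q.1} → ℝ,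
      Set.indicator {w : {q : Fin r × Fin r // q.2 ≤ q.1} → ℝ | (lowerToSym w).PosDef}
        (fun w => invWishartDensity r ν S (lowerToSym w) * Real.log (lowerToSym w).det) v =
      c⁻¹ * (invWishartKernel (ν / 2) S (lowerToSym v) * Real.log (lowerToSym v).det) := by
    intro v
    by_cases hv : (lowerToSym v).PosDef
    · rw [Set.indicator_of_mem (by exact hv), invWishartKernel_of_posDef _ _ hv,
        invWishartDensity, hc, Real.rpow_neg hd.le,
        show -(ν * (r : ℝ)) / 2 = -(ν / 2 * r) by ring, Real.rpow_neg two_pos.le,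
        show -(ν + (r : ℝ) + 1) / 2 = -(ν / 2) - ((r : ℝ) + 1) / 2 by ring]
      field_simp
    · rw [Set.indicator_of_notMem (by exact hv), invWishartKernel_of_not_posDef _ _ hv]
      simp
  rw [spdIntegral]
  simp only [hint]
  rw [integral_const_mul, integral_invWishartKernel_mul_log_det ha hS, ← hc,
    inv_mul_cancel_left₀ hc0]
  have hl : ∀ l : ℕ, (ν - (l : ℝ) + 1) / 2 = ν / 2 + (1 - (l : ℝ)) / 2 := fun l => by ring
  simp only [hl]
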